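/- Let (Xₙ)ₙ≥₀ be an IFS of iid Lipschitz maps Ψ, Ψ₁, Ψ₂, … on a complete separable metric space (𝕏,d) with unbounded d, with a stationary law π and fixed x₀ ∈ 𝕏; for r > 0 define M̲(r) = inf_{d(x₀,x)>r} d(x₀,Ψ(x))/d(x₀,x), M̄(r) = sup_{d(x₀,x)>r} d(x₀,Ψ(x))/d(x₀,x), Q̲(r) = inf_{d(x₀,x)≤r} d(x₀,Ψ(x)), Q̄(r) = sup_{d(x₀,x)≤r} d(x₀,Ψ(x)). (a) Suppose for some r > 0: M̲(r) and M̄(r) satisfy (IRT-1)–(IRT-3) with κ = α(r) and κ = β(r) respectively; P(Q̲(r) > r) > 0 and E Q̲(r)^{α(r)} < ∞; and 0 < E Q̄(r)^{β(r)} < ∞. Then the lower and upper tail indices θ_*, θ^* of the law of d(x₀,X₀) under π satisfy β(r) ≤ θ_* ≤ θ^* ≤ α(r). (b) If these assumptions hold for all sufficiently large r, then β ≤ θ_* ≤ θ^* ≤ α, where α = lim_{r→∞} α(r) and β = lim_{r→∞} β(r) (α(r) is nonincreasing and β(r) nondecreasing in r). (c) If moreover α = β, then the law of d(x₀,X₀)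 under π has tail index α. -/

import Mathlib

open MeasureTheory ProbabilityTheory Filter Set

noncomputable section

/-- Conditions (IRT-1)–(IRT-3) of Goldie's implicit renewal theorem. -/
def SatisfiesIRT {Θ : Type*} [MeasurableSpace Θ] (ν : Measure Θ) (M : Θ → ℝ) (κ : ℝ) :
    Prop :=
  0 < κ ∧
  (∫ p, |M p| ^ κ ∂ν) = 1 ∧
  Integrable (fun p => |M p| ^ κ * max (Real.log |M p|) 0) ν ∧
  ∀ c : ℝ, 0 < ν {p | M p ≠ 0 ∧ ∀ k : ℤ, Real.log |M p| ≠ c * k}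

/-- `M̲(r) = inf_{d(x₀,x)>r} d(x₀,Ψ(x))/d(x₀,x)`. -/
def Mlo {𝕏 Θ : Type*} [MetricSpace 𝕏] (Ψ : Θ → 𝕏 → 𝕏) (x₀ : 𝕏) (r : ℝ) (p : Θ) : ℝ :=
  sInf {m : ℝ | ∃ y : 𝕏, r < dist x₀ y ∧ m = dist x₀ (Ψ p y) / dist x₀ y}

/-- `M̄(r) = sup_{d(x₀,x)>r} d(x₀,Ψ(x))/d(x₀,x)`. -/
def Mhi {𝕏 Θ : Type*} [MetricSpace 𝕏] (Ψ : Θ → 𝕏 → 𝕏) (x₀ : 𝕏) (r : ℝ) (p : Θ) : ℝ :=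
  sSup {m : ℝ | ∃ y : 𝕏, r < dist x₀ y ∧ m = dist x₀ (Ψ p y) / dist x₀ y}

/-- `Q̲(r) = inf_{d(x₀,x)≤r} d(x₀,Ψ(x))`. -/
def Qlo {𝕏 Θ : Type*} [MetricSpace 𝕏] (Ψ : Θ → 𝕏 → 𝕏) (x₀ : 𝕏) (r : ℝ) (p : Θ) : ℝ :=
  sInf {q : ℝ | ∃ y : 𝕏, dist x₀ y ≤ r ∧ q = dist x₀ (Ψ p y)}

/-- `Q̄(r) = sup_{d(x₀,x)≤r} d(x₀,Ψ(x))`. -/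
def Qhi {𝕏 Θ : Type*} [MetricSpace 𝕏] (Ψ : Θ → 𝕏 → 𝕏) (x₀ : 𝕏) (r : ℝ) (p : Θ) : ℝ :=
  sSup {q : ℝ | ∃ y : 𝕏, dist x₀ y ≤ r ∧ q = dist x₀ (Ψ p y)}

/-- The hypotheses (TB-1)–(TB-3) at level `r` with exponents `a = α(r)`, `b = β(r)`. -/
def TBHyp {𝕏 Θ : Type*} [MetricSpace 𝕏] [MeasurableSpace Θ]
    (ν : Measure Θ) (Ψ : Θ → 𝕏 → 𝕏) (x₀ : 𝕏) (r a b : ℝ) : Prop :=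
  SatisfiesIRT ν (Mlo Ψ x₀ r) a ∧ SatisfiesIRT ν (Mhi Ψ x₀ r) b ∧
  0 < ν {p | r < Qlo Ψ x₀ r p} ∧
  Integrable (fun p => Qlo Ψ x₀ r p ^ a) ν ∧
  Integrable (fun p => Qhi Ψ x₀ r p ^ b) ν ∧
  0 < ∫ p, Qhi Ψ x₀ r p ^ b ∂ν

/-- Strict Young-type inequality between powers of a nonnegative number other than one. -/
theorem rpow_lt_convex_comb {m s b : ℝ} (hm : 0 ≤ m) (hm1 : m ≠ 1) (hs : 0 < s) (hsb : s < b) :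
    m ^ s < s / b * m ^ b + (1 - s / b) := by
  have hb : 0 < b := hs.trans hsb
  have hmb : 0 ≤ m ^ b := Real.rpow_nonneg hm b
  have hne : m ^ b - 1 ≠ 0 := by
    intro h
    refine hm1 ((Real.rpow_left_inj hm zero_le_one hb.ne').1 ?_)
    rw [Real.one_rpow]; linarith
  have h := rpow_one_add_lt_one_add_mul_self (s := m ^ b - 1) (p := s / b) (by linarith) hne
    (by positivity) ((div_lt_one hb).2 hsb)
  rw [add_sub_cancel, ← Real.rpow_mul hm, mul_div_cancel₀ _ hb.ne'] at h
  linarith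

theorem rpow_le_convex_comb {m s b : ℝ} (hm : 0 ≤ m) (hs : 0 < s) (hsb : s < b) :
    m ^ s ≤ s / b * m ^ b + (1 - s / b) := by
  by_cases h : m = 1
  · simp [h]
  · exact (rpow_lt_convex_comb hm h hs hsb).le

theorem aemeasurable_of_rpow {Θ : Type*} [MeasurableSpace Θ] {ν : Measure Θ} {g : Θ → ℝ} {κ : ℝ}
    (hκ : 0 < κ) (hg : ∀ p, 0 ≤ g p) (h : AEMeasurable (fun p => g p ^ κ) ν) :
    AEMeasurable g ν := by
  have := h.pow_const κ⁻¹
  refine this.congr (Eventually.of_forall fun p => ?_)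
  exact Real.rpow_rpow_inv (hg p) hκ.ne'

theorem integrable_rpow_of_le {Θ : Type*} [MeasurableSpace Θ] {ν : Measure Θ}
    [IsFiniteMeasure ν] {g : Θ → ℝ} {s b : ℝ} (hs : 0 < s) (hsb : s < b)
    (hg : ∀ p, 0 ≤ g p) (h : Integrable (fun p => g p ^ b) ν) :
    Integrable (fun p => g p ^ s) ν := by
  have hm := aemeasurable_of_rpow (hs.trans hsb) hg h.aemeasurable
  refine Integrable.mono' ((h.const_mul (s / b)).add (integrable_const (1 - s / b)))
    (hm.pow_const s).aestronglyMeasurable (Eventually.of_forall fun p => ?_)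
  rw [Real.norm_of_nonneg (Real.rpow_nonneg (hg p) s)]
  exact rpow_le_convex_comb (hg p) hs hsb

/-- Strict monotonicity of `s ↦ E g ^ s` through the level one. -/
theorem integral_rpow_lt {Θ : Type*} [MeasurableSpace Θ] {ν : Measure Θ}
    [IsProbabilityMeasure ν] {g : Θ → ℝ} {s b : ℝ} (hs : 0 < s) (hsb : s < b)
    (hg : ∀ p, 0 ≤ g p) (h1 : 0 < ν {p | g p ≠ 1}) (h : Integrable (fun p => g p ^ b) ν) :
    ∫ p, g p ^ s ∂ν < s / b * (∫ p, g p ^ b ∂ν) + (1 - s / b) := by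
  have hi := integrable_rpow_of_le hs hsb hg h
  have hc : Integrable (fun p => s / b * g p ^ b + (1 - s / b)) ν :=
    (h.const_mul (s / b)).add (integrable_const (1 - s / b))
  have hpos : 0 < ∫ p, (s / b * g p ^ b + (1 - s / b) - g p ^ s) ∂ν := by
    rw [integral_pos_iff_support_of_nonneg
      (fun p => sub_nonneg.2 (rpow_le_convex_comb (hg p) hs hsb)) (hc.sub hi)]
    refine h1.trans_le (measure_mono fun p hp => ?_)
    exact (sub_pos.2 (rpow_lt_convex_comb (hg p) hp hs hsb)).ne'
  rw [integral_sub hc hi, integral_add (h.const_mul _) (integrable_const _),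
    integral_const_mul] at hpos
  simp at hpos
  linarith

namespace SatisfiesIRT

variable {Θ : Type*} [MeasurableSpace Θ] {ν : Measure Θ} {M : Θ → ℝ} {κ : ℝ}

theorem integrable (h : SatisfiesIRT ν M κ) : Integrable (fun p => |M p| ^ κ) ν := by
  by_contra hn
  have := h.2.1
  rw [integral_undef hn] at this
  exact zero_ne_one this

theorem measure_abs_ne_one_pos (h : SatisfiesIRT ν M κ) : 0 < ν {p | |M p| ≠ 1} := by
  refine (h.2.2.2 0).trans_le (measure_mono fun p hp => ?_)
  intro (h1 : |M p| = 1)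
  apply hp.2 0
  rw [h1, Real.log_one, zero_mul]

theorem integral_rpow_lt_one [IsProbabilityMeasure ν] (h : SatisfiesIRT ν M κ) {s : ℝ}
    (hs : 0 < s) (hsκ : s < κ) : ∫ p, |M p| ^ s ∂ν < 1 := by
  have := integral_rpow_lt hs hsκ (fun p => abs_nonneg (M p)) h.measure_abs_ne_one_pos h.integrable
  rw [h.2.1] at this
  linarith

theorem aemeasurable_abs (h : SatisfiesIRT ν M κ) : AEMeasurable (fun p => |M p|) ν :=
  aemeasurable_of_rpow h.1 (fun p => abs_nonneg (M p)) h.integrable.aemeasurable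

/-- Above the exponent `κ`, a truncated moment exceeds one. -/
theorem exists_truncation [IsProbabilityMeasure ν] (h : SatisfiesIRT ν M κ) {s : ℝ}
    (hs : κ < s) :
    ∃ K : ℝ, 1 ≤ K ∧ Integrable ({p | |M p| ≤ K}.indicator fun p => |M p| ^ s) ν ∧
      1 < ∫ p, {p | |M p| ≤ K}.indicator (fun p => |M p| ^ s) p ∂ν := by
  have hs0 : 0 < s := h.1.trans hs
  have hmeas := h.aemeasurable_abs
  have hms := hmeas.pow_const s
  have hnn : ∀ p, 0 ≤ |M p| ^ s := fun p => Real.rpow_nonneg (abs_nonneg _) s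
  have hset : ∀ K : ℝ, NullMeasurableSet {p | |M p| ≤ K} ν := fun K =>
    hmeas.nullMeasurableSet_preimage measurableSet_Iic
  have hgt : 1 < ∫⁻ p, ENNReal.ofReal (|M p| ^ s) ∂ν := by
    by_cases hi : Integrable (fun p => |M p| ^ s) ν
    · rw [← ofReal_integral_eq_lintegral_ofReal hi (Eventually.of_forall hnn)]
      have := integral_rpow_lt h.1 hs (fun p => abs_nonneg (M p)) h.measure_abs_ne_one_pos hi
      rw [h.2.1] at this
      rw [← ENNReal.ofReal_one]
      refine (ENNReal.ofReal_lt_ofReal_iff_of_nonneg zero_le_one).2 ?_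
      have hks : 0 < κ / s := div_pos h.1 hs0
      nlinarith
    · have : ∫⁻ p, ENNReal.ofReal (|M p| ^ s) ∂ν = ⊤ := by
        by_contra hne
        exact hi ((lintegral_ofReal_ne_top_iff_integrable hms.aestronglyMeasurable
          (Eventually.of_forall hnn)).1 hne)
      rw [this]; exact ENNReal.one_lt_top
  have hlim : Tendsto (fun n : ℕ => ∫⁻ p, ENNReal.ofReal
      ({p | |M p| ≤ (n : ℝ)}.indicator (fun p => |M p| ^ s) p) ∂ν) atTop
      (nhds (∫⁻ p, ENNReal.ofReal (|M p| ^ s) ∂ν)) := by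
    refine lintegral_tendsto_of_tendsto_of_monotone
      (fun n => (hms.indicator₀ (hset n)).ennreal_ofReal)
      (Eventually.of_forall fun p m n hmn => ?_) (Eventually.of_forall fun p => ?_)
    · refine ENNReal.ofReal_le_ofReal (indicator_le_indicator_of_subset ?_ hnn p)
      intro q hq
      have hq' : |M q| ≤ m := hq
      exact hq'.trans (Nat.cast_le.2 hmn)
    · refine tendsto_const_nhds.congr' ?_
      obtain ⟨N, hN⟩ := exists_nat_ge |M p|
      filter_upwards [eventually_ge_atTop N] with n hn
      rw [indicator_of_mem]
      exact hN.trans (Nat.cast_le.2 hn)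
  obtain ⟨n, hn, hn1⟩ := ((hlim.eventually (lt_mem_nhds hgt)).and (eventually_ge_atTop 1)).exists
  have hint : Integrable ({p | |M p| ≤ (n : ℝ)}.indicator fun p => |M p| ^ s) ν := by
    refine Integrable.of_bound (hms.indicator₀ (hset n)).aestronglyMeasurable ((n : ℝ) ^ s)
      (Eventually.of_forall fun p => ?_)
    rw [Real.norm_of_nonneg (indicator_nonneg (fun p _ => hnn p) p)]
    refine indicator_apply_le' (fun hp => ?_) (fun _ => by positivity)
    exact Real.rpow_le_rpow (abs_nonneg _) hp hs0.le
  refine ⟨n, by exact_mod_cast hn1, hint, ?_⟩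
  rw [← ofReal_integral_eq_lintegral_ofReal hint
    (Eventually.of_forall (indicator_nonneg fun p _ => hnn p)), ← ENNReal.ofReal_one] at hn
  exact (ENNReal.ofReal_lt_ofReal_iff_of_nonneg zero_le_one).1 hn

theorem exists_measure_gt_pos [IsProbabilityMeasure ν] (h : SatisfiesIRT ν M κ) :
    ∃ l : ℝ, 1 < l ∧ 0 < ν {p | l < |M p|} := by
  by_contra! hcon
  have hle : ∀ᵐ p ∂ν, |M p| ≤ 1 := by
    have hall : ∀ᵐ p ∂ν, ∀ n : ℕ, |M p| ≤ 1 + 1 / ((n : ℝ) + 1) := by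
      refine ae_all_iff.2 fun n => ?_
      have := hcon (1 + 1 / ((n : ℝ) + 1)) (by simp; positivity)
      rw [ae_iff]
      simpa using this
    filter_upwards [hall] with p hp
    have : Tendsto (fun n : ℕ => 1 + 1 / ((n : ℝ) + 1)) atTop (nhds (1 + 0)) :=
      tendsto_const_nhds.add tendsto_one_div_add_atTop_nhds_zero_nat
    rw [add_zero] at this
    exact ge_of_tendsto' this hp
  obtain ⟨K, -, hint, hK⟩ := h.exists_truncation (lt_add_one κ)
  have : ∫ p, {p | |M p| ≤ K}.indicator (fun p => |M p| ^ (κ + 1)) p ∂ν ≤ ∫ _, (1 : ℝ) ∂ν := by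
    refine integral_mono_ae hint (integrable_const 1) ?_
    filter_upwards [hle] with p hp
    refine indicator_apply_le' (fun _ => ?_) (fun _ => zero_le_one)
    exact Real.rpow_le_one (abs_nonneg _) hp (by linarith [h.1])
  simp at this
  linarith

end SatisfiesIRT

/-- A function improving every bound `δ + A t ^ (-s)` to `δ + (ρ A + C) t ^ (-s)` obeys
the fixed-point bound. -/
theorem le_rpow_of_contraction {F : ℝ → ℝ} {ρ C s : ℝ} (hF1 : ∀ t, F t ≤ 1)
    (hF0 : Tendsto F atTop (nhds 0)) (hρ0 : 0 ≤ ρ) (hρ1 : ρ < 1) (hC : 0 ≤ C) (hs : 0 < s)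
    (step : ∀ δ A : ℝ, 0 ≤ δ → 0 ≤ A → (∀ t, 0 < t → F t ≤ δ + A * t ^ (-s)) →
      ∀ t, 0 < t → F t ≤ δ + (ρ * A + C) * t ^ (-s)) {t : ℝ} (ht : 0 < t) :
    F t ≤ C / (1 - ρ) * t ^ (-s) := by
  refine le_of_forall_pos_le_add fun δ hδ => ?_
  have hρ : 0 < 1 - ρ := by linarith
  obtain ⟨T, hT⟩ := eventually_atTop.1 (hF0.eventually (gt_mem_nhds hδ))
  set T' := max T 1 with hT'
  have hT'0 : 0 < T' := lt_max_of_lt_right one_pos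
  have key : ∀ n : ℕ, ∀ t, 0 < t →
      F t ≤ δ + (C / (1 - ρ) + ρ ^ n * T' ^ s) * t ^ (-s) := by
    intro n
    induction n with
    | zero =>
      intro t ht
      have hts : 0 < t ^ (-s) := Real.rpow_pos_of_pos ht _
      have hTs : 0 < T' ^ s := Real.rpow_pos_of_pos hT'0 _
      have hCr : 0 ≤ C / (1 - ρ) := by positivity
      rcases le_or_gt T' t with h | h
      · have := hT t ((le_max_left _ _).trans h)
        have : 0 ≤ (C / (1 - ρ) + ρ ^ 0 * T' ^ s) * t ^ (-s) := by positivity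
        linarith
      · have h1 : 1 ≤ T' ^ s * t ^ (-s) := by
          rw [Real.rpow_neg ht.le, ← div_eq_mul_inv, one_le_div (by positivity)]
          exact Real.rpow_le_rpow ht.le h.le hs.le
        have := hF1 t
        have : 0 ≤ C / (1 - ρ) * t ^ (-s) := by positivity
        rw [pow_zero]
        linarith
    | succ n ih =>
      intro t ht
      have := step δ _ hδ.le (by positivity) ih t ht
      convert this using 3
      field_simp
      ring
  have hlim : Tendsto (fun n : ℕ => δ + (C / (1 - ρ) + ρ ^ n * T' ^ s) * t ^ (-s)) atTop
      (nhds (δ + (C / (1 - ρ) + 0 * T' ^ s) * t ^ (-s))) :=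
    tendsto_const_nhds.add ((tendsto_const_nhds.add
      ((tendsto_pow_atTop_nhds_zero_of_lt_one hρ0 hρ1).mul_const _)).mul_const _)
  have := ge_of_tendsto' hlim fun n => key n t ht
  simp only [zero_mul, add_zero] at this
  linarith

/-- A nonnegative function improving every bound `c t ^ (-s) - A t ^ (-q)` by shrinking `A`
dominates `c t ^ (-s)`. -/
theorem rpow_le_of_contraction {F : ℝ → ℝ} {l c s q r : ℝ} (hF0 : ∀ t, 0 ≤ F t) (hr : 0 < r)
    (hl0 : 0 ≤ l) (hl1 : l < 1) (hc : 0 ≤ c) (hqs : q < s)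
    (step : ∀ A : ℝ, 0 ≤ A → (∀ t, r ≤ t → c * t ^ (-s) - A * t ^ (-q) ≤ F t) →
      ∀ t, r ≤ t → c * t ^ (-s) - l * A * t ^ (-q) ≤ F t) {t : ℝ} (ht : r ≤ t) :
    c * t ^ (-s) ≤ F t := by
  have key : ∀ n : ℕ, ∀ t, r ≤ t →
      c * t ^ (-s) - l ^ n * (c * r ^ (q - s)) * t ^ (-q) ≤ F t := by
    intro n
    induction n with
    | zero =>
      intro t ht
      have ht0 : 0 < t := hr.trans_le ht
      have h1 : t ^ (q - s) ≤ r ^ (q - s) :=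
        Real.rpow_le_rpow_of_nonpos hr ht (by linarith)
      have h2 : t ^ (-s) = t ^ (q - s) * t ^ (-q) := by
        rw [← Real.rpow_add ht0]; congr 1; ring
      have h3 : c * (t ^ (q - s) * t ^ (-q)) ≤ c * (r ^ (q - s) * t ^ (-q)) := by gcongr
      have := hF0 t
      rw [h2, pow_zero]
      linarith
    | succ n ih =>
      intro t ht
      have := step _ (by positivity) ih t ht
      convert this using 3
      ring
  have hlim : Tendsto (fun n : ℕ => c * t ^ (-s) - l ^ n * (c * r ^ (q - s)) * t ^ (-q)) atTop
      (nhds (c * t ^ (-s) - 0 * (c * r ^ (q - s)) * t ^ (-q))) :=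
    tendsto_const_nhds.sub
      (((tendsto_pow_atTop_nhds_zero_of_lt_one hl0 hl1).mul_const _).mul_const _)
  have := le_of_tendsto' hlim fun n => key n t ht
  simpa using this

section Sandwich

variable {𝕏 Θ : Type*} [MetricSpace 𝕏] {Ψ : Θ → 𝕏 → 𝕏} {x₀ : 𝕏} {r : ℝ}

theorem Mlo_nonneg (p : Θ) : 0 ≤ Mlo Ψ x₀ r p :=
  Real.sInf_nonneg fun _ ⟨_, _, h⟩ => h ▸ div_nonneg dist_nonneg dist_nonneg

theorem Mhi_nonneg (p : Θ) : 0 ≤ Mhi Ψ x₀ r p :=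
  Real.sSup_nonneg fun _ ⟨_, _, h⟩ => h ▸ div_nonneg dist_nonneg dist_nonneg

theorem Qhi_nonneg (p : Θ) : 0 ≤ Qhi Ψ x₀ r p :=
  Real.sSup_nonneg fun _ ⟨_, _, h⟩ => h ▸ dist_nonneg

theorem Mlo_mul_le (hr : 0 < r) (p : Θ) {y : 𝕏} (hy : r < dist x₀ y) :
    Mlo Ψ x₀ r p * dist x₀ y ≤ dist x₀ (Ψ p y) := by
  rw [← le_div_iff₀ (hr.trans hy)]
  exact csInf_le ⟨0, fun _ ⟨_, _, h⟩ => h ▸ div_nonneg dist_nonneg dist_nonneg⟩ ⟨y, hy, rfl⟩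

theorem Qlo_le (p : Θ) {y : 𝕏} (hy : dist x₀ y ≤ r) :
    Qlo Ψ x₀ r p ≤ dist x₀ (Ψ p y) :=
  csInf_le ⟨0, fun _ ⟨_, _, h⟩ => h ▸ dist_nonneg⟩ ⟨y, hy, rfl⟩

theorem dist_map_le (hΨlip : ∀ p, ∃ K : NNReal, LipschitzWith K (Ψ p)) (p : Θ) :
    ∃ K : NNReal, ∀ y, dist x₀ (Ψ p y) ≤ dist x₀ (Ψ p x₀) + K * dist x₀ y := by
  obtain ⟨K, hK⟩ := hΨlip p
  exact ⟨K, fun y => (dist_triangle _ (Ψ p x₀) _).trans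
    (add_le_add_right (hK.dist_le_mul x₀ y) _)⟩

theorem le_Mhi_mul (hΨlip : ∀ p, ∃ K : NNReal, LipschitzWith K (Ψ p)) (hr : 0 < r) (p : Θ)
    {y : 𝕏} (hy : r < dist x₀ y) : dist x₀ (Ψ p y) ≤ Mhi Ψ x₀ r p * dist x₀ y := by
  rw [← div_le_iff₀ (hr.trans hy)]
  refine le_csSup ?_ ⟨y, hy, rfl⟩
  obtain ⟨K, hK⟩ := dist_map_le (x₀ := x₀) hΨlip p
  refine ⟨dist x₀ (Ψ p x₀) / r + K, ?_⟩
  rintro _ ⟨z, hz, rfl⟩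
  have hz0 : 0 < dist x₀ z := hr.trans hz
  rw [div_le_iff₀ hz0, add_mul]
  refine (hK z).trans (add_le_add_left ?_ _)
  rw [div_mul_eq_mul_div, le_div_iff₀ hr]
  exact mul_le_mul_of_nonneg_left hz.le dist_nonneg

theorem le_Qhi (hΨlip : ∀ p, ∃ K : NNReal, LipschitzWith K (Ψ p)) (p : Θ)
    {y : 𝕏} (hy : dist x₀ y ≤ r) : dist x₀ (Ψ p y) ≤ Qhi Ψ x₀ r p := by
  refine le_csSup ?_ ⟨y, hy, rfl⟩
  obtain ⟨K, hK⟩ := dist_map_le (x₀ := x₀) hΨlip p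
  refine ⟨dist x₀ (Ψ p x₀) + K * r, ?_⟩
  rintro _ ⟨z, hz, rfl⟩
  exact (hK z).trans (by gcongr)

end Sandwich

section Tail

variable {𝕏 Θ : Type*} [MetricSpace 𝕏] [MeasurableSpace 𝕏] {Ψ : Θ → 𝕏 → 𝕏}
  {π : Measure 𝕏} {x₀ : 𝕏} {r a b : ℝ}

/-- The tail function of `d(x₀, X₀)` under `π`. -/
def tail (π : Measure 𝕏) (x₀ : 𝕏) (t : ℝ) : ℝ := π.real {y | t < dist x₀ y}

/-- The tail function of `d(x₀, Ψ(X₀))` under `π` for a fixed realization of the map. -/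
def stepTail (Ψ : Θ → 𝕏 → 𝕏) (π : Measure 𝕏) (x₀ : 𝕏) (t : ℝ) (p : Θ) : ℝ :=
  π.real {y | t < dist x₀ (Ψ p y)}

theorem stepTail_nonneg {t : ℝ} (p : Θ) : 0 ≤ stepTail Ψ π x₀ t p := measureReal_nonneg

variable [IsProbabilityMeasure π]

theorem tail_antitone : Antitone (tail π x₀) := fun _ _ h =>
  measureReal_mono fun _ hy => lt_of_le_of_lt h hy

theorem tail_le_stepTail (hr : 0 < r) {t u : ℝ} (hu : r ≤ u) {p : Θ}
    (h : t ≤ Mlo Ψ x₀ r p * u) (h0 : 0 < Mlo Ψ x₀ r p) :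
    tail π x₀ u ≤ stepTail Ψ π x₀ t p := by
  refine measureReal_mono fun y hy => ?_
  have hy' : u < dist x₀ y := hy
  calc t ≤ Mlo Ψ x₀ r p * u := h
    _ < Mlo Ψ x₀ r p * dist x₀ y := by gcongr
    _ ≤ _ := Mlo_mul_le hr p (hu.trans_lt hy')

variable [BorelSpace 𝕏] [SecondCountableTopology 𝕏] [MeasurableSpace Θ] {ν : Measure Θ}
  [IsProbabilityMeasure ν]

theorem tail_tendsto_zero : Tendsto (tail π x₀) atTop (nhds 0) := by
  have hm : Measurable (dist x₀) := measurable_const.dist measurable_id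
  have h := tendsto_measure_iInter_atTop (μ := π) (s := fun t : ℝ => {y | t < dist x₀ y})
    (fun t => (measurableSet_lt measurable_const hm).nullMeasurableSet)
    (fun _ _ h _ hy => lt_of_le_of_lt h hy) ⟨0, measure_ne_top _ _⟩
  have hem : ⋂ t : ℝ, {y | t < dist x₀ y} = ∅ := by
    refine eq_empty_of_forall_notMem fun y hy => ?_
    have hlt : dist x₀ y < dist x₀ y := mem_iInter.1 hy (dist x₀ y)
    exact lt_irrefl _ hlt
  rw [hem, measure_empty] at h
  exact (ENNReal.tendsto_toReal ENNReal.zero_ne_top).comp h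

theorem measurableSet_stepTail (hΨmeas : Measurable fun q : Θ × 𝕏 => Ψ q.1 q.2) (t : ℝ) :
    MeasurableSet {q : 𝕏 × Θ | t < dist x₀ (Ψ q.2 q.1)} :=
  measurableSet_lt measurable_const
    (measurable_const.dist (hΨmeas.comp measurable_swap))

theorem integrable_stepTail (hΨmeas : Measurable fun q : Θ × 𝕏 => Ψ q.1 q.2) (t : ℝ) :
    Integrable (stepTail Ψ π x₀ t) ν := by
  refine Integrable.of_bound (C := 1)
    (measurable_measure_prodMk_right
      (measurableSet_stepTail hΨmeas t)).ennreal_toReal.aestronglyMeasurable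
    (Eventually.of_forall fun p => ?_)
  rw [Real.norm_of_nonneg (stepTail_nonneg p)]
  exact measureReal_le_one

theorem tail_eq_integral (hΨmeas : Measurable fun q : Θ × 𝕏 => Ψ q.1 q.2)
    (hπstat : Measure.map (fun q : 𝕏 × Θ => Ψ q.2 q.1) (π.prod ν) = π) (t : ℝ) :
    tail π x₀ t = ∫ p, stepTail Ψ π x₀ t p ∂ν := by
  have hm : Measurable (dist x₀) := measurable_const.dist measurable_id
  have hS := measurableSet_stepTail (x₀ := x₀) hΨmeas t
  have hmap : Measurable fun q : 𝕏 × Θ => Ψ q.2 q.1 := hΨmeas.comp measurable_swap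
  have h1 : π {y | t < dist x₀ y} = ∫⁻ p, π {y | t < dist x₀ (Ψ p y)} ∂ν := by
    conv_lhs => rw [← hπstat]
    rw [Measure.map_apply hmap (measurableSet_lt measurable_const hm)]
    exact Measure.prod_apply_symm hS
  rw [tail, Measure.real, h1]
  exact (integral_toReal (measurable_measure_prodMk_right hS).aemeasurable
    (Eventually.of_forall fun p => measure_lt_top _ _)).symm

theorem tail_pos_of_stepTail_pos (hΨmeas : Measurable fun q : Θ × 𝕏 => Ψ q.1 q.2)
    (hπstat : Measure.map (fun q : 𝕏 × Θ => Ψ q.2 q.1) (π.prod ν) = π) {t : ℝ} {S : Set Θ}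
    (hS : 0 < ν S) (h : ∀ p ∈ S, 0 < stepTail Ψ π x₀ t p) : 0 < tail π x₀ t := by
  rw [tail_eq_integral hΨmeas hπstat, integral_pos_iff_support_of_nonneg
    stepTail_nonneg (integrable_stepTail hΨmeas t)]
  exact hS.trans_le (measure_mono fun p hp => (h p hp).ne')

theorem tail_le_rpow (hΨmeas : Measurable fun q : Θ × 𝕏 => Ψ q.1 q.2)
    (hΨlip : ∀ p, ∃ K : NNReal, LipschitzWith K (Ψ p))
    (hπstat : Measure.map (fun q : 𝕏 × Θ => Ψ q.2 q.1) (π.prod ν) = π)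
    (hr : 0 < r) (hM : SatisfiesIRT ν (Mhi Ψ x₀ r) b)
    (hQ : Integrable (fun p => Qhi Ψ x₀ r p ^ b) ν) {s : ℝ} (hs : 0 < s) (hsb : s < b) :
    ∃ C : ℝ, ∀ t, 0 < t → tail π x₀ t ≤ C * t ^ (-s) := by
  have hMeq : ∀ p, |Mhi Ψ x₀ r p| = Mhi Ψ x₀ r p := fun p => abs_of_nonneg (Mhi_nonneg p)
  have hρ1 := hM.integral_rpow_lt_one hs hsb
  have hMi := integrable_rpow_of_le hs hsb (fun p => abs_nonneg _) hM.integrable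
  have hQi := integrable_rpow_of_le hs hsb (fun p => Qhi_nonneg p) hQ
  simp only [hMeq] at hρ1 hMi
  refine ⟨_, fun t ht => le_rpow_of_contraction (F := tail π x₀) (fun t => measureReal_le_one)
    tail_tendsto_zero (integral_nonneg fun p => Real.rpow_nonneg (Mhi_nonneg p) s) hρ1
    (C := ∫ p, Qhi Ψ x₀ r p ^ s ∂ν)
    (integral_nonneg fun p => Real.rpow_nonneg (Qhi_nonneg p) s) hs ?_ ht⟩
  intro δ A hδ hA hF t ht
  have hts : 0 < t ^ (-s) := Real.rpow_pos_of_pos ht _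
  have hpt : ∀ p, stepTail Ψ π x₀ t p ≤
      δ + (A * t ^ (-s)) * Mhi Ψ x₀ r p ^ s + t ^ (-s) * Qhi Ψ x₀ r p ^ s := by
    intro p
    have hM0 := Mhi_nonneg (Ψ := Ψ) (x₀ := x₀) (r := r) p
    have hQ0 := Qhi_nonneg (Ψ := Ψ) (x₀ := x₀) (r := r) p
    have hMs := Real.rpow_nonneg hM0 s
    have hQs := Real.rpow_nonneg hQ0 s
    rcases lt_or_ge t (Qhi Ψ x₀ r p) with h | h
    · have h1 : 1 ≤ t ^ (-s) * Qhi Ψ x₀ r p ^ s := by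
        rw [Real.rpow_neg ht.le, mul_comm, ← div_eq_mul_inv, one_le_div (by positivity)]
        exact Real.rpow_le_rpow ht.le h.le hs.le
      have h2 : stepTail Ψ π x₀ t p ≤ 1 := measureReal_le_one
      have : 0 ≤ (A * t ^ (-s)) * Mhi Ψ x₀ r p ^ s := by positivity
      linarith
    · have hsub : {y | t < dist x₀ (Ψ p y)} ⊆ {y | t < Mhi Ψ x₀ r p * dist x₀ y} := by
        intro y hy
        rcases le_or_gt (dist x₀ y) r with hyr | hyr
        · exact absurd ((le_Qhi hΨlip p hyr).trans h) (not_le.2 hy)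
        · exact lt_of_lt_of_le hy (le_Mhi_mul hΨlip hr p hyr)
      have hle : stepTail Ψ π x₀ t p ≤ π.real {y | t < Mhi Ψ x₀ r p * dist x₀ y} :=
        measureReal_mono hsub
      have hlast : 0 ≤ t ^ (-s) * Qhi Ψ x₀ r p ^ s := by positivity
      rcases hM0.eq_or_lt with h0 | h0
      · have : {y | t < Mhi Ψ x₀ r p * dist x₀ y} = ∅ := by
          refine eq_empty_of_forall_notMem fun y hy => ?_
          have hy' : t < Mhi Ψ x₀ r p * dist x₀ y := hy
          rw [← h0, zero_mul] at hy'
          exact lt_asymm ht hy'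
        rw [this, measureReal_empty] at hle
        have : 0 ≤ (A * t ^ (-s)) * Mhi Ψ x₀ r p ^ s := by positivity
        linarith
      · have heq : {y | t < Mhi Ψ x₀ r p * dist x₀ y} = {y | t / Mhi Ψ x₀ r p < dist x₀ y} := by
          ext y; exact (div_lt_iff₀' h0).symm
        rw [heq] at hle
        have h3 := hF (t / Mhi Ψ x₀ r p) (by positivity)
        rw [Real.div_rpow ht.le h0.le, Real.rpow_neg h0.le, div_inv_eq_mul, ← mul_assoc] at h3
        rw [tail] at h3
        linarith
  calc tail π x₀ t = ∫ p, stepTail Ψ π x₀ t p ∂ν := tail_eq_integral hΨmeas hπstat t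
    _ ≤ ∫ p, (δ + (A * t ^ (-s)) * Mhi Ψ x₀ r p ^ s + t ^ (-s) * Qhi Ψ x₀ r p ^ s) ∂ν :=
        integral_mono (integrable_stepTail hΨmeas t)
          (((integrable_const δ).add (hMi.const_mul _)).add (hQi.const_mul _)) hpt
    _ = _ := by
        have hi : Integrable (fun p => δ + (A * t ^ (-s)) * Mhi Ψ x₀ r p ^ s) ν :=
          (integrable_const δ).add (hMi.const_mul _)
        rw [integral_add hi (hQi.const_mul _),
          integral_add (integrable_const δ) (hMi.const_mul _), integral_const_mul,
          integral_const_mul, integral_const, probReal_univ, one_smul]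
        ring

theorem tail_pos (hΨmeas : Measurable fun q : Θ × 𝕏 => Ψ q.1 q.2)
    (hπstat : Measure.map (fun q : 𝕏 × Θ => Ψ q.2 q.1) (π.prod ν) = π)
    (hr : 0 < r) (hM : SatisfiesIRT ν (Mlo Ψ x₀ r) a)
    (hQ : 0 < ν {p | r < Qlo Ψ x₀ r p}) (t : ℝ) : 0 < tail π x₀ t := by
  have hm : Measurable (dist x₀) := measurable_const.dist measurable_id
  have hbase : 0 < tail π x₀ r := by
    by_contra hcon
    have h0 : tail π x₀ r = 0 := le_antisymm (not_lt.1 hcon) measureReal_nonneg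
    refine hcon (tail_pos_of_stepTail_pos hΨmeas hπstat hQ fun p hp => ?_)
    have h1 : π.real {y | r < dist x₀ y}ᶜ = 1 := by
      rw [probReal_compl_eq_one_sub (measurableSet_lt measurable_const hm)]
      rw [tail] at h0
      rw [h0, sub_zero]
    have hle : π.real {y | r < dist x₀ y}ᶜ ≤ stepTail Ψ π x₀ r p := by
      refine measureReal_mono fun y hy => ?_
      have hy' : dist x₀ y ≤ r := not_lt.1 hy
      exact lt_of_lt_of_le hp (Qlo_le p hy')
    linarith
  obtain ⟨l, hl, hlpos⟩ := hM.exists_measure_gt_pos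
  have hl0 : 0 < l := one_pos.trans hl
  have hiter : ∀ n : ℕ, 0 < tail π x₀ (l ^ n * r) := by
    intro n
    induction n with
    | zero => simpa using hbase
    | succ n ih =>
      refine tail_pos_of_stepTail_pos hΨmeas hπstat hlpos fun p hp => ?_
      have hp' : l < Mlo Ψ x₀ r p := by
        have : l < |Mlo Ψ x₀ r p| := hp
        rwa [abs_of_nonneg (Mlo_nonneg p)] at this
      refine ih.trans_le (tail_le_stepTail hr ?_ ?_ (hl0.trans hp'))
      · exact le_mul_of_one_le_left hr.le (one_le_pow₀ hl.le)
      · rw [pow_succ', mul_assoc]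
        gcongr
  obtain ⟨n, hn⟩ := pow_unbounded_of_one_lt (t / r) hl
  rw [div_lt_iff₀ hr] at hn
  exact (hiter n).trans_le (tail_antitone hn.le)

theorem rpow_le_tail (hΨmeas : Measurable fun q : Θ × 𝕏 => Ψ q.1 q.2)
    (hπstat : Measure.map (fun q : 𝕏 × Θ => Ψ q.2 q.1) (π.prod ν) = π)
    (hr : 0 < r) (hM : SatisfiesIRT ν (Mlo Ψ x₀ r) a)
    (hQ : 0 < ν {p | r < Qlo Ψ x₀ r p}) {s : ℝ} (has : a < s) :
    ∃ c : ℝ, 0 < c ∧ ∀ t, r ≤ t → c * t ^ (-s) ≤ tail π x₀ t := by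
  have ha : 0 < a := hM.1
  have hMeq : ∀ p, |Mlo Ψ x₀ r p| = Mlo Ψ x₀ r p := fun p => abs_of_nonneg (Mlo_nonneg p)
  obtain ⟨K, hK1, hKi, hK⟩ := hM.exists_truncation has
  have hq : 0 < a / 2 := by linarith
  have hqa : a / 2 < a := by linarith
  have hl1 := hM.integral_rpow_lt_one hq hqa
  have hqi := integrable_rpow_of_le hq hqa (fun p => abs_nonneg _) hM.integrable
  simp only [hMeq] at hl1 hqi hKi hK
  have hK0 : 0 < K := one_pos.trans_le hK1
  have hc : 0 < tail π x₀ (r * K) * r ^ s :=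
    mul_pos (tail_pos hΨmeas hπstat hr hM hQ _) (Real.rpow_pos_of_pos hr _)
  refine ⟨_, hc, fun t ht => rpow_le_of_contraction (F := tail π x₀) (q := a / 2)
    (fun t => measureReal_nonneg) hr
    (integral_nonneg fun p => Real.rpow_nonneg (Mlo_nonneg p) _) hl1 hc.le (by linarith) ?_ ht⟩
  generalize hcdef : tail π x₀ (r * K) * r ^ s = c at hc
  intro A hA hF t ht
  have ht0 : 0 < t := hr.trans_le ht
  have hts : 0 < t ^ (-s) := Real.rpow_pos_of_pos ht0 _
  have htq : 0 < t ^ (-(a / 2)) := Real.rpow_pos_of_pos ht0 _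
  have hlnn : 0 ≤ ∫ p, Mlo Ψ x₀ r p ^ (a / 2) ∂ν :=
    integral_nonneg fun p => Real.rpow_nonneg (Mlo_nonneg p) _
  rcases le_or_gt t (r * K) with htK | htK
  · have h1 : c * t ^ (-s) ≤ c * r ^ (-s) :=
      mul_le_mul_of_nonneg_left (Real.rpow_le_rpow_of_nonpos hr ht (by linarith)) hc.le
    have h2 : c * r ^ (-s) = tail π x₀ (r * K) := by
      rw [← hcdef, mul_assoc, ← Real.rpow_add hr]; simp
    have h3 : tail π x₀ (r * K) ≤ tail π x₀ t := tail_antitone htK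
    have : 0 ≤ (∫ p, Mlo Ψ x₀ r p ^ (a / 2) ∂ν) * A * t ^ (-(a / 2)) := by positivity
    linarith
  have hpt : ∀ p, (c * t ^ (-s)) * {p | Mlo Ψ x₀ r p ≤ K}.indicator
        (fun p => Mlo Ψ x₀ r p ^ s) p - (A * t ^ (-(a / 2))) * Mlo Ψ x₀ r p ^ (a / 2)
      ≤ stepTail Ψ π x₀ t p := by
    intro p
    have hM0 := Mlo_nonneg (Ψ := Ψ) (x₀ := x₀) (r := r) p
    have hMq := Real.rpow_nonneg hM0 (a / 2)
    have hnn : 0 ≤ stepTail Ψ π x₀ t p := measureReal_nonneg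
    have hsec : 0 ≤ (A * t ^ (-(a / 2))) * Mlo Ψ x₀ r p ^ (a / 2) := by positivity
    by_cases hp : Mlo Ψ x₀ r p ≤ K
    · rw [indicator_of_mem (by exact hp)]
      rcases hM0.eq_or_lt with h0 | h0
      · have h2 : Mlo Ψ x₀ r p ^ s = 0 := by rw [← h0, Real.zero_rpow (ha.trans has).ne']
        rw [h2]
        linarith
      · have hu : r ≤ t / Mlo Ψ x₀ r p := by
          rw [le_div_iff₀ h0]
          exact (mul_le_mul_of_nonneg_left hp hr.le).trans htK.le
        have h3 := (hF _ hu).trans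
          (tail_le_stepTail (t := t) hr hu (mul_div_cancel₀ t h0.ne').ge h0)
        rw [Real.div_rpow ht0.le h0.le, Real.rpow_neg h0.le, div_inv_eq_mul, ← mul_assoc,
          Real.div_rpow ht0.le h0.le, Real.rpow_neg h0.le, div_inv_eq_mul, ← mul_assoc] at h3
        exact h3
    · rw [indicator_of_notMem (by exact hp)]
      linarith
  have hi : Integrable (fun p => (c * t ^ (-s)) * {p | Mlo Ψ x₀ r p ≤ K}.indicator
        (fun p => Mlo Ψ x₀ r p ^ s) p - (A * t ^ (-(a / 2))) * Mlo Ψ x₀ r p ^ (a / 2)) ν :=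
    (hKi.const_mul _).sub (hqi.const_mul _)
  have hint := integral_mono hi (integrable_stepTail hΨmeas t) hpt
  rw [← tail_eq_integral hΨmeas hπstat, integral_sub (hKi.const_mul _) (hqi.const_mul _), integral_const_mul,
    integral_const_mul] at hint
  have h4 : c * t ^ (-s) ≤ c * t ^ (-s) *
      ∫ p, {p | Mlo Ψ x₀ r p ≤ K}.indicator (fun p => Mlo Ψ x₀ r p ^ s) p ∂ν :=
    le_mul_of_one_le_right (by positivity) hK.le
  linarith

theorem log_tail_div_log_bounds (hΨmeas : Measurable fun q : Θ × 𝕏 => Ψ q.1 q.2)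
    (hΨlip : ∀ p, ∃ K : NNReal, LipschitzWith K (Ψ p))
    (hπstat : Measure.map (fun q : 𝕏 × Θ => Ψ q.2 q.1) (π.prod ν) = π)
    (hr : 0 < r) (h : TBHyp ν Ψ x₀ r a b) {ε : ℝ} (hε : 0 < ε) :
    ∀ᶠ x : ℝ in atTop,
      -a - ε ≤ Real.log ((Measure.map (dist x₀) π (Ioi x)).toReal) / Real.log x ∧
      Real.log ((Measure.map (dist x₀) π (Ioi x)).toReal) / Real.log x ≤ -b + ε := by
  obtain ⟨hMlo, hMhi, hQpos, -, hQhi, -⟩ := h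
  have hm : Measurable (dist x₀) := measurable_const.dist measurable_id
  have htail : ∀ x : ℝ, (Measure.map (dist x₀) π (Ioi x)).toReal = tail π x₀ x := fun x => by
    rw [Measure.map_apply hm measurableSet_Ioi]; rfl
  simp only [htail]
  have hb : 0 < b := hMhi.1
  obtain ⟨c, hc, hlow⟩ := rpow_le_tail hΨmeas hπstat hr hMlo hQpos
    (show a < a + ε / 2 by linarith)
  obtain ⟨s, hs1, hs2⟩ := exists_between (show max 0 (b - ε) < b from max_lt hb (by linarith))
  have hs0 : 0 < s := (le_max_left _ _).trans_lt hs1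
  have hsε : b - ε < s := (le_max_right _ _).trans_lt hs1
  obtain ⟨C, hup⟩ := tail_le_rpow hΨmeas hΨlip hπstat hr hMhi hQhi hs0 hs2
  have hlogs : ∀ y η : ℝ, 0 < η → ∀ᶠ x : ℝ in atTop, |y| ≤ η * Real.log x := fun y η hη =>
    (Real.tendsto_log_atTop.const_mul_atTop hη).eventually_ge_atTop _
  filter_upwards [eventually_ge_atTop r, eventually_gt_atTop 1,
    hlogs (Real.log c) (ε / 2) (by linarith), hlogs (Real.log C) (s - (b - ε)) (by linarith)]
    with x hxr hx1 hxc hxC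
  have hx0 : 0 < x := one_pos.trans hx1
  have hlx : 0 < Real.log x := Real.log_pos hx1
  have hFpos : 0 < tail π x₀ x := tail_pos hΨmeas hπstat hr hMlo hQpos x
  have hxs : 0 < x ^ (-s) := Real.rpow_pos_of_pos hx0 _
  have hxa : 0 < x ^ (-(a + ε / 2)) := Real.rpow_pos_of_pos hx0 _
  constructor
  · rw [le_div_iff₀ hlx]
    have := Real.log_le_log (by positivity) (hlow x hxr)
    rw [Real.log_mul hc.ne' hxa.ne', Real.log_rpow hx0] at this
    have := neg_abs_le (Real.log c)
    linarith
  · rw [div_le_iff₀ hlx]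
    have hCx := hup x hx0
    have hC0 : 0 < C := pos_of_mul_pos_left (hFpos.trans_le hCx) hxs.le
    have := Real.log_le_log hFpos hCx
    rw [Real.log_mul hC0.ne' hxs.ne', Real.log_rpow hx0] at this
    have := le_abs_self (Real.log C)
    linarith

end Tail

/-- Approximate eventual bounds control the limit superior and the limit inferior. -/
theorem limsup_le_and_le_liminf {f : ℝ → ℝ} {lo hi : ℝ}
    (h : ∀ ε : ℝ, 0 < ε → ∀ᶠ x in atTop, lo - ε ≤ f x ∧ f x ≤ hi + ε) :
    limsup f atTop ≤ hi ∧ lo ≤ liminf f atTop := by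
  have hlo : IsBoundedUnder (· ≥ ·) atTop f := ⟨lo - 1, (h 1 one_pos).mono fun _ hx => hx.1⟩
  have hhi : IsBoundedUnder (· ≤ ·) atTop f := ⟨hi + 1, (h 1 one_pos).mono fun _ hx => hx.2⟩
  constructor
  · exact le_of_forall_pos_le_add fun ε hε =>
      limsup_le_of_le hlo.isCoboundedUnder_le ((h ε hε).mono fun _ hx => hx.2)
  · refine le_of_forall_pos_le_add fun ε hε => sub_le_iff_le_add.1 ?_
    exact le_liminf_of_le hhi.isCoboundedUnder_ge ((h ε hε).mono fun _ hx => hx.1)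

/-- **Tail index bounds via the canonical sandwich functions.**
(a) If (TB-1)–(TB-3) hold at some `r > 0` with exponents `α(r)`, `β(r)`, then the
lower/upper tail indices of the law of `d(x₀,X₀)` under a stationary law `π` satisfy
`β(r) ≤ ϑ_* ≤ ϑ^* ≤ α(r)`, i.e. `limsup log P(d>x)/log x ≤ -β(r)` and
`-α(r) ≤ liminf log P(d>x)/log x`.
(b) If they hold for all `r ≥ r₀` then `β ≤ ϑ_* ≤ ϑ^* ≤ α` for the limits
`α = lim α(r)`, `β = lim β(r)`; (c) if moreover `α = β`, the law of `d(x₀,X₀)` has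
tail index `α`. -/
theorem tail_index_bounds
    {𝕏 Θ : Type*}
    [MetricSpace 𝕏] [CompleteSpace 𝕏] [TopologicalSpace.SeparableSpace 𝕏]
    [MeasurableSpace 𝕏] [BorelSpace 𝕏] [MeasurableSpace Θ]
    (hunb : ∀ R : ℝ, ∃ x y : 𝕏, R < dist x y)
    (ν : Measure Θ) [IsProbabilityMeasure ν]
    (Ψ : Θ → 𝕏 → 𝕏) (hΨmeas : Measurable fun q : Θ × 𝕏 => Ψ q.1 q.2)
    (hΨlip : ∀ p, ∃ K : NNReal, LipschitzWith K (Ψ p))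
    (π : Measure 𝕏) [IsProbabilityMeasure π]
    (hπstat : Measure.map (fun q : 𝕏 × Θ => Ψ q.2 q.1) (π.prod ν) = π)
    (x₀ : 𝕏) :
    -- (a)
    (∀ r : ℝ, 0 < r → ∀ a b : ℝ, TBHyp ν Ψ x₀ r a b →
      limsup (fun x : ℝ =>
          Real.log ((Measure.map (dist x₀) π (Ioi x)).toReal) / Real.log x) atTop
        ≤ -b ∧
      -a ≤ liminf (fun x : ℝ =>
          Real.log ((Measure.map (dist x₀) π (Ioi x)).toReal) / Real.log x) atTop) ∧
    -- (b) and (c)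
    (∀ r₀ : ℝ, 0 < r₀ → ∀ af bf : ℝ → ℝ,
      (∀ r : ℝ, r₀ ≤ r → TBHyp ν Ψ x₀ r (af r) (bf r)) →
      ∀ α β : ℝ, Tendsto af atTop (nhds α) → Tendsto bf atTop (nhds β) →
        (limsup (fun x : ℝ =>
            Real.log ((Measure.map (dist x₀) π (Ioi x)).toReal) / Real.log x) atTop
          ≤ -β ∧
        -α ≤ liminf (fun x : ℝ =>
            Real.log ((Measure.map (dist x₀) π (Ioi x)).toReal) / Real.log x) atTop) ∧
        (α = β → 0 < α ∧
          Tendsto (fun x : ℝ =>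
              Real.log ((Measure.map (dist x₀) π (Ioi x)).toReal) / Real.log x) atTop
            (nhds (-α)))) := by
  have : SecondCountableTopology 𝕏 := UniformSpace.secondCountable_of_separable 𝕏
  have key := fun {r a b : ℝ} (hr : 0 < r) (h : TBHyp ν Ψ x₀ r a b) =>
    limsup_le_and_le_liminf fun ε hε =>
      log_tail_div_log_bounds hΨmeas hΨlip hπstat hr h hε
  refine ⟨fun r hr a b h => key hr h, fun r₀ hr₀ af bf hTB α β hα hβ => ?_⟩
  have hev : ∀ᶠ r in atTop, 0 < r ∧ r₀ ≤ r :=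
    (eventually_gt_atTop 0).and (eventually_ge_atTop r₀)
  have hsup := ge_of_tendsto hβ.neg (hev.mono fun r hr => (key hr.1 (hTB r hr.2)).1)
  have hinf := le_of_tendsto hα.neg (hev.mono fun r hr => (key hr.1 (hTB r hr.2)).2)
  refine ⟨⟨hsup, hinf⟩, fun hαβ => ?_⟩
  have h₀ := hTB r₀ le_rfl
  have hbd := log_tail_div_log_bounds hΨmeas hΨlip hπstat hr₀ h₀ one_pos
  have hlo := isBoundedUnder_of_eventually_ge (hbd.mono fun _ hx => hx.1)
  have hhi := isBoundedUnder_of_eventually_le (hbd.mono fun _ hx => hx.2)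
  refine ⟨?_, tendsto_of_le_liminf_of_limsup_le hinf (hαβ ▸ hsup) hhi hlo⟩
  have h1 := liminf_le_limsup hhi hlo
  have h2 := (key hr₀ h₀).1
  have h3 : 0 < bf r₀ := h₀.2.1.1
  linarith
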